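/- arXiv:2307.01988 — 7 statements merged into one kernel-verified Lean document; each statement's English description precedes it below -/
import Mathlib

section
/- (Theorem 2.1, deterministic one-step contraction of iGRK.) Let A ∈ ℝ^{m×n} have nonzero rows, let Ax = b be consistent, let x⁰ ∈ ℝⁿ and x* = A†b + (I − A†A)x⁰. Let (x^k) be generated by the iGRK iteration, where at each step Ax^k ≠ b, Γ_k = Γ(x^k), an arbitrary index i_k is chosen from J_k = {i : |⟨a_i,x^k⟩ − b_i|²/‖a_i‖₂² ≥ ½( max_{j∈[m]} |⟨a_j,x^k⟩ − b_j|²/‖a_j‖₂² + ‖Ax^k − b‖₂²/Γ_k )}, and x^{k+1} = x^k − ((⟨a_{i_k},x^k⟩ − b_{i_k})/‖a_{i_k}‖₂²)·a_{i_k}. Then for every k ≥ 0, ‖x^{k+1} − x*‖₂² ≤ (1 − σ_min²(A)/Γ_k)·‖x^k − x*‖₂², regardless of which i_k ∈ J_k is selected. -/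
open scoped RealInnerProductSpace BigOperators

/-- Pythagorean identity for the projection onto the hyperplane orthogonal to `v`. -/
theorem norm_sub_inner_div_smul_sq {E : Type*} [NormedAddCommGroup E] [InnerProductSpace ℝ E]
    {v : E} (hv : v ≠ 0) (z : E) :
    ‖z - (⟪v, z⟫ / ‖v‖ ^ 2) • v‖ ^ 2 = ‖z‖ ^ 2 - ⟪v, z⟫ ^ 2 / ‖v‖ ^ 2 := by
  have h : ‖v‖ ≠ 0 := norm_ne_zero_iff.mpr hv
  rw [norm_sub_sq_real, real_inner_smul_right, real_inner_comm, norm_smul, mul_pow,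
    Real.norm_eq_abs, sq_abs]
  field_simp
  ring

/-- A common bound for the ratios `r j ^ 2 / w j` bounds the ratio of the sums, where the
denominator may be restricted to the support of `r`. -/
theorem sum_sq_div_sum_support_le {ι : Type*} [Fintype ι] (r w : ι → ℝ) (hw : ∀ j, 0 < w j)
    (S : Finset ι) (hS : ∀ j, j ∉ S → r j = 0) (hne : S.Nonempty) {M : ℝ}
    (hM : ∀ j, r j ^ 2 / w j ≤ M) :
    (∑ j, r j ^ 2) / ∑ j ∈ S, w j ≤ M := by
  rw [div_le_iff₀ (Finset.sum_pos (fun j _ => hw j) hne), Finset.mul_sum,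
    ← Finset.sum_subset (Finset.subset_univ S) fun j _ hj => by rw [hS j hj]; norm_num]
  exact Finset.sum_le_sum fun j _ => (div_le_iff₀ (hw j)).mp (hM j)

/-- Theorem 2.1: deterministic one-step contraction of iGRK.
`xs = A†b + (I - A†A)x⁰` is encoded by its characteristic properties
`⟪a i, xs⟫ = b i` and `x 0 - xs ∈ Range(Aᵀ) = span {a₁,…,a_m}`.
`σ` is the smallest nonzero singular value of `A`, encoded by `σ > 0` and
`σ²‖z‖² ≤ ‖Az‖² = ∑ i ⟪a i, z⟫²` for every `z ∈ Range(Aᵀ)`.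
At each step `Ax^k ≠ b`, `i_k` is an arbitrary index in the greedy set `J_k`
(with threshold parameter `Γ_k = Γ(x^k)`), and `x^{k+1}` is the Kaczmarz projection. -/
theorem iGRK_one_step_contraction {m n : ℕ} [Nonempty (Fin m)]
    (a : Fin m → EuclideanSpace ℝ (Fin n)) (b : Fin m → ℝ)
    (ha : ∀ i, a i ≠ 0)
    (xs : EuclideanSpace ℝ (Fin n)) (hxs : ∀ i, ⟪a i, xs⟫ = b i)
    (σ : ℝ) (hσpos : 0 < σ)
    (hσ : ∀ z ∈ Submodule.span ℝ (Set.range a), σ ^ 2 * ‖z‖ ^ 2 ≤ ∑ i, ⟪a i, z⟫ ^ 2)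
    (x : ℕ → EuclideanSpace ℝ (Fin n))
    (hx0 : x 0 - xs ∈ Submodule.span ℝ (Set.range a))
    (idx : ℕ → Fin m)
    (hne : ∀ k : ℕ, ∃ i, ⟪a i, x k⟫ ≠ b i)
    (hik : ∀ k : ℕ,
      (⟪a (idx k), x k⟫ - b (idx k)) ^ 2 / ‖a (idx k)‖ ^ 2 ≥
        (1 / 2) *
          ((Finset.univ.sup' Finset.univ_nonempty fun j => (⟪a j, x k⟫ - b j) ^ 2 / ‖a j‖ ^ 2) +
            (∑ j, (⟪a j, x k⟫ - b j) ^ 2) /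
              (∑ j ∈ Finset.univ.filter (fun j => ⟪a j, x k⟫ ≠ b j), ‖a j‖ ^ 2)))
    (hrec : ∀ k : ℕ,
      x (k + 1) = x k - ((⟪a (idx k), x k⟫ - b (idx k)) / ‖a (idx k)‖ ^ 2) • a (idx k)) :
    ∀ k : ℕ,
      ‖x (k + 1) - xs‖ ^ 2 ≤
        (1 - σ ^ 2 / (∑ j ∈ Finset.univ.filter (fun j => ⟪a j, x k⟫ ≠ b j), ‖a j‖ ^ 2)) *
          ‖x k - xs‖ ^ 2 := by
  have hres : ∀ k i, ⟪a i, x k⟫ - b i = ⟪a i, x k - xs⟫ := fun k i => by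
    rw [inner_sub_right, hxs]
  have hmem : ∀ k, x k - xs ∈ Submodule.span ℝ (Set.range a) := by
    intro k
    induction k with
    | zero => exact hx0
    | succ k ih =>
      rw [hrec k, sub_right_comm]
      exact Submodule.sub_mem _ ih
        (Submodule.smul_mem _ _ (Submodule.subset_span (Set.mem_range_self _)))
  intro k
  have hw : ∀ j, 0 < ‖a j‖ ^ 2 := fun j => pow_pos (norm_pos_iff.mpr (ha j)) 2
  have hsup := sum_sq_div_sum_support_le
    (M := Finset.univ.sup' Finset.univ_nonempty fun j => (⟪a j, x k⟫ - b j) ^ 2 / ‖a j‖ ^ 2)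
    (fun j => ⟪a j, x k⟫ - b j) (fun j => ‖a j‖ ^ 2) hw
    (Finset.univ.filter fun j => ⟪a j, x k⟫ ≠ b j)
    (fun j hj => by simpa [sub_eq_zero] using hj)
    (by obtain ⟨i, hi⟩ := hne k; exact ⟨i, by simpa using hi⟩)
    (fun j => Finset.le_sup' (fun j => (⟪a j, x k⟫ - b j) ^ 2 / ‖a j‖ ^ 2) (Finset.mem_univ j))
  have hgreedy := hik k
  have hstep := norm_sub_inner_div_smul_sq (ha (idx k)) (x k - xs)
  rw [← hres, sub_right_comm, ← hrec k] at hstep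
  have hbound : σ ^ 2 * ‖x k - xs‖ ^ 2 ≤ ∑ j, (⟪a j, x k⟫ - b j) ^ 2 := by
    simpa only [hres] using hσ _ (hmem k)
  have hdiv := div_le_div_of_nonneg_right hbound
    (Finset.sum_nonneg fun j (_ : j ∈ Finset.univ.filter fun j => ⟪a j, x k⟫ ≠ b j) => (hw j).le)
  rw [hstep, sub_mul, one_mul, div_mul_eq_mul_div]
  linarith
end

section
/- (Corollary 2.2.) Let A ∈ ℝ^{m×n} with m ≥ 2 have nonzero rows, let Ax = b be consistent, x⁰ ∈ ℝⁿ, x* = A†b + (I − A†A)x⁰, and let γ = max_{i∈[m]} Σ_{j≠i} ‖a_j‖₂². Let (x^k) be generated by the iGRK iteration (at each step Ax^k ≠ b, Γ_k = Γ(x^k), arbitrary i_k ∈ J_k = {i : |⟨a_i,x^k⟩ − b_i|²/‖a_i‖₂² ≥ ½( max_j |⟨a_j,x^k⟩ − b_j|²/‖a_j‖₂² + ‖Ax^k − b‖₂²/Γ_k )}, and x^{k+1} = x^k − ((⟨a_{i_k},x^k⟩ − b_{i_k})/‖a_{i_k}‖₂²)a_{i_k}). Then for every k ≥ 1 such that the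 iterates x^1, …, x^k are generated, ‖x^k − x*‖₂² ≤ (1 − σ_min²(A)/γ)^{k−1} · (1 − σ_min²(A)/‖A‖_F²) · ‖x⁰ − x*‖₂². -/
open scoped RealInnerProductSpace BigOperators

section Kaczmarz

variable {ι E : Type*} [Fintype ι] [NormedAddCommGroup E] [InnerProductSpace ℝ E]

/-- Pythagorean identity for the orthogonal projection onto the hyperplane `⟪a, ·⟫ = 0`. -/
theorem norm_sub_inner_div_smul_sq_s5 {a : E} (ha : a ≠ 0) (e : E) :
    ‖e - (⟪a, e⟫ / ‖a‖ ^ 2) • a‖ ^ 2 = ‖e‖ ^ 2 - ⟪a, e⟫ ^ 2 / ‖a‖ ^ 2 := by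
  have h : ‖a‖ ≠ 0 := norm_ne_zero_iff.mpr ha
  rw [norm_sub_sq_real, inner_smul_right, norm_smul, mul_pow, Real.norm_eq_abs, sq_abs,
    real_inner_comm]
  field_simp
  ring

/-- The projection onto the hyperplane `⟪a, ·⟫ = β` lies on that hyperplane. -/
theorem inner_sub_residual_div_smul {a : E} (ha : a ≠ 0) (y : E) (β : ℝ) :
    ⟪a, y - ((⟪a, y⟫ - β) / ‖a‖ ^ 2) • a⟫ = β := by
  have h : ‖a‖ ≠ 0 := norm_ne_zero_iff.mpr ha
  rw [inner_sub_right, inner_smul_right, real_inner_self_eq_norm_sq]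
  field_simp
  ring

/-- The average of the squared residuals, weighted over the violated equations, is at most
the largest relative squared residual. -/
theorem sum_sq_div_le_sup' [Nonempty ι] (r w : ι → ℝ) (hw : ∀ i, 0 < w i)
    (hr : ∃ i, r i ≠ 0) :
    (∑ j, r j ^ 2) / (∑ j with r j ≠ 0, w j) ≤
      Finset.univ.sup' Finset.univ_nonempty fun j => r j ^ 2 / w j := by
  obtain ⟨i, hi⟩ := hr
  rw [div_le_iff₀ (Finset.sum_pos (fun j _ => hw j) ⟨i, by simpa using hi⟩), Finset.mul_sum,
    ← Finset.sum_filter_of_ne (p := fun j => r j ≠ 0) fun j _ hj h => hj (by simp [h])]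
  refine Finset.sum_le_sum fun j _ => ?_
  rw [← div_le_iff₀ (hw j)]
  exact Finset.le_sup' (fun j => r j ^ 2 / w j) (Finset.mem_univ j)

/-- One greedy Kaczmarz step contracts the squared error by `1 - σ² / C` whenever the total
squared norm of the rows of the violated equations is at most `C`. -/
theorem norm_sq_greedy_step_le [Nonempty ι] {a : ι → E} {b : ι → ℝ} (ha : ∀ i, a i ≠ 0)
    {y z : E} (hz : ∀ i, ⟪a i, z⟫ = b i) {σ C : ℝ}
    (hσ : σ ^ 2 * ‖y - z‖ ^ 2 ≤ ∑ i, ⟪a i, y - z⟫ ^ 2)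
    (hne : ∃ i, ⟪a i, y⟫ ≠ b i)
    (hC : ∑ j with ⟪a j, y⟫ ≠ b j, ‖a j‖ ^ 2 ≤ C) {i : ι}
    (hi : (⟪a i, y⟫ - b i) ^ 2 / ‖a i‖ ^ 2 ≥
        (1 / 2) *
          ((Finset.univ.sup' Finset.univ_nonempty fun j => (⟪a j, y⟫ - b j) ^ 2 / ‖a j‖ ^ 2) +
            (∑ j, (⟪a j, y⟫ - b j) ^ 2) / (∑ j with ⟪a j, y⟫ ≠ b j, ‖a j‖ ^ 2))) :
    ‖y - ((⟪a i, y⟫ - b i) / ‖a i‖ ^ 2) • a i - z‖ ^ 2 ≤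
      (1 - σ ^ 2 / C) * ‖y - z‖ ^ 2 := by
  have hpos : ∀ j, 0 < ‖a j‖ ^ 2 := fun j => pow_pos (norm_pos_iff.mpr (ha j)) 2
  have hres : ∀ j, ⟪a j, y - z⟫ = ⟪a j, y⟫ - b j := fun j => by rw [inner_sub_right, hz]
  have havg := sum_sq_div_le_sup' (fun j => ⟪a j, y⟫ - b j) (fun j => ‖a j‖ ^ 2) hpos
    (by simpa only [sub_ne_zero] using hne)
  simp only [sub_ne_zero] at havg
  have hΓ : 0 < ∑ j with ⟪a j, y⟫ ≠ b j, ‖a j‖ ^ 2 := by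
    obtain ⟨j, hj⟩ := hne
    exact Finset.sum_pos (fun j _ => hpos j) ⟨j, by simpa using hj⟩
  simp only [hres] at hσ
  have hrate : σ ^ 2 * ‖y - z‖ ^ 2 / C ≤
      (∑ j, (⟪a j, y⟫ - b j) ^ 2) / (∑ j with ⟪a j, y⟫ ≠ b j, ‖a j‖ ^ 2) :=
    div_le_div₀ (Finset.sum_nonneg fun j _ => sq_nonneg _) hσ hΓ hC
  rw [sub_right_comm, ← hres, norm_sub_inner_div_smul_sq_s5 (ha i), hres, sub_mul, one_mul,
    div_mul_eq_mul_div]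
  linarith

end Kaczmarz

/-- Corollary 2.2: deterministic linear convergence of iGRK with the
improved rate `(1 - σ²/γ)^(k-1) (1 - σ²/‖A‖_F²)`, where
`γ = max_{i∈[m]} ∑_{j≠i} ‖a_j‖₂²`.  The projection `xs = A†b + (I - A†A)x⁰` is
encoded by `⟪a i, xs⟫ = b i` and `x 0 - xs ∈ Range(Aᵀ) = span {a₁,…,a_m}`, and the
smallest nonzero singular value `σ` by `σ > 0` and
`σ²‖z‖² ≤ ∑ i ⟪a i, z⟫²` for `z ∈ Range(Aᵀ)`. -/
theorem iGRK_deterministic_linear_convergence {m n : ℕ} [Nonempty (Fin m)] (hm : 2 ≤ m)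
    (a : Fin m → EuclideanSpace ℝ (Fin n)) (b : Fin m → ℝ)
    (ha : ∀ i, a i ≠ 0)
    (xs : EuclideanSpace ℝ (Fin n)) (hxs : ∀ i, ⟪a i, xs⟫ = b i)
    (σ : ℝ) (hσpos : 0 < σ)
    (hσ : ∀ z ∈ Submodule.span ℝ (Set.range a), σ ^ 2 * ‖z‖ ^ 2 ≤ ∑ i, ⟪a i, z⟫ ^ 2)
    (x : ℕ → EuclideanSpace ℝ (Fin n))
    (hx0 : x 0 - xs ∈ Submodule.span ℝ (Set.range a))
    (idx : ℕ → Fin m)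
    (hne : ∀ k : ℕ, ∃ i, ⟪a i, x k⟫ ≠ b i)
    (hik : ∀ k : ℕ,
      (⟪a (idx k), x k⟫ - b (idx k)) ^ 2 / ‖a (idx k)‖ ^ 2 ≥
        (1 / 2) *
          ((Finset.univ.sup' Finset.univ_nonempty fun j => (⟪a j, x k⟫ - b j) ^ 2 / ‖a j‖ ^ 2) +
            (∑ j, (⟪a j, x k⟫ - b j) ^ 2) /
              (∑ j ∈ Finset.univ.filter (fun j => ⟪a j, x k⟫ ≠ b j), ‖a j‖ ^ 2)))
    (hrec : ∀ k : ℕ,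
      x (k + 1) = x k - ((⟪a (idx k), x k⟫ - b (idx k)) / ‖a (idx k)‖ ^ 2) • a (idx k)) :
    ∀ k : ℕ, 1 ≤ k →
      ‖x k - xs‖ ^ 2 ≤
        (1 - σ ^ 2 / (Finset.univ.sup' Finset.univ_nonempty fun i =>
              ∑ j ∈ Finset.univ.erase i, ‖a j‖ ^ 2)) ^ (k - 1) *
          ((1 - σ ^ 2 / ∑ j, ‖a j‖ ^ 2) * ‖x 0 - xs‖ ^ 2) := by
  have hmem : ∀ k, x k - xs ∈ Submodule.span ℝ (Set.range a) := by
    intro k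
    induction k with
    | zero => exact hx0
    | succ k ih =>
      rw [hrec, sub_right_comm]
      exact sub_mem ih (Submodule.smul_mem _ _ (Submodule.subset_span ⟨_, rfl⟩))
  have hstep : ∀ k C, (∑ j with ⟪a j, x k⟫ ≠ b j, ‖a j‖ ^ 2 ≤ C) →
      ‖x (k + 1) - xs‖ ^ 2 ≤ (1 - σ ^ 2 / C) * ‖x k - xs‖ ^ 2 := by
    intro k C hC
    rw [hrec]
    exact norm_sq_greedy_step_le ha hxs (hσ _ (hmem k)) (hne k) hC (hik k)
  set γ := Finset.univ.sup' Finset.univ_nonempty fun i => ∑ j ∈ Finset.univ.erase i, ‖a j‖ ^ 2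
  have hγ : ∀ k, ∑ j with ⟪a j, x (k + 1)⟫ ≠ b j, ‖a j‖ ^ 2 ≤ γ := by
    intro k
    refine le_trans (Finset.sum_le_sum_of_subset_of_nonneg ?_ fun j _ _ => sq_nonneg _)
      (Finset.le_sup' (fun i => ∑ j ∈ Finset.univ.erase i, ‖a j‖ ^ 2)
        (Finset.mem_univ (idx k)))
    intro j hj
    refine Finset.mem_erase.mpr ⟨?_, Finset.mem_univ j⟩
    rintro rfl
    refine (Finset.mem_filter.mp hj).2 ?_
    rw [hrec]
    exact inner_sub_residual_div_smul (ha _) _ _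
  have hfactor : 0 ≤ 1 - σ ^ 2 / γ := by
    have hpos : 0 < ‖x 1 - xs‖ ^ 2 := by
      refine pow_pos (norm_pos_iff.mpr (sub_ne_zero.mpr fun h => ?_)) 2
      obtain ⟨i, hi⟩ := hne 1
      exact hi (h ▸ hxs i)
    exact nonneg_of_mul_nonneg_left ((sq_nonneg _).trans (hstep 1 γ (hγ 0))) hpos
  intro k hk
  induction k, hk using Nat.le_induction with
  | base =>
    simpa using hstep 0 _ (Finset.sum_le_sum_of_subset_of_nonneg (Finset.filter_subset _ _)
      fun j _ _ => sq_nonneg _)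
  | succ k hk ih =>
    obtain ⟨l, rfl⟩ := Nat.exists_eq_add_of_le' hk
    refine (hstep (l + 1) γ (hγ l)).trans ((mul_le_mul_of_nonneg_left ih hfactor).trans_eq ?_)
    simp only [Nat.add_sub_cancel]
    ring
end

section
/- (Deterministic convergence of the original GRK method.) Let A ∈ ℝ^{m×n} with m ≥ 2 have nonzero rows, let Ax = b be consistent, x⁰ ∈ ℝⁿ, x* = A†b + (I − A†A)x⁰, and γ = max_{i∈[m]} Σ_{j≠i} ‖a_j‖₂². Let (x^k) be generated by the GRK iteration: at each step Ax^k ≠ b, an arbitrary index i_k is chosen from I_k = {i : |⟨a_i,x^k⟩ − b_i|²/‖a_i‖₂² ≥ ½( max_{j∈[m]} |⟨a_j,x^k⟩ − b_j|²/‖a_j‖₂² + ‖Ax^k − b‖₂²/‖A‖_F² )}, and x^{k+1} = x^k − ((⟨a_{i_k},x^k⟩ − b_{i_k})/‖a_{i_k}‖₂²)a_{i_k}. Then for every k ≥ 1 such that the iterates are generated, ‖x^k − x*‖₂² ≤ (1 − ½(‖A‖_F²/γ + 1)·σ_min²(A)/‖A‖_F²)^{k−1} · (1 − σ_min²(A)/‖A‖_F²)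 · ‖x⁰ − x*‖₂², regardless of the choices of i_k ∈ I_k. -/
open scoped RealInnerProductSpace BigOperators

section Kaczmarz

variable {E ι : Type*} [NormedAddCommGroup E] [InnerProductSpace ℝ E]

lemma norm_sub_smul_inner_div_sq (a e : E) :
    ‖e - (⟪a, e⟫ / ‖a‖ ^ 2) • a‖ ^ 2 = ‖e‖ ^ 2 - ⟪a, e⟫ ^ 2 / ‖a‖ ^ 2 := by
  rcases eq_or_ne a 0 with rfl | ha
  · simp
  have hn : ‖a‖ ≠ 0 := norm_ne_zero_iff.mpr ha
  rw [norm_sub_sq_real, inner_smul_right, norm_smul, mul_pow, Real.norm_eq_abs, sq_abs,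
    real_inner_comm]
  field_simp
  ring

lemma inner_sub_smul_inner_div (a e : E) :
    ⟪a, e - (⟪a, e⟫ / ‖a‖ ^ 2) • a⟫ = 0 := by
  rcases eq_or_ne a 0 with rfl | ha
  · simp
  have hn : ‖a‖ ≠ 0 := norm_ne_zero_iff.mpr ha
  rw [inner_sub_right, inner_smul_right, real_inner_self_eq_norm_sq]
  field_simp
  ring

/-- The weighted mean of the residuals `⟪a j, e⟫² / ‖a j‖²` over `s` is at most any upper bound. -/
lemma sum_inner_sq_le_mul_sum_norm_sq (a : ι → E) (ha : ∀ i, a i ≠ 0) (e : E) (s : Finset ι)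
    {M : ℝ} (hM : ∀ j, ⟪a j, e⟫ ^ 2 / ‖a j‖ ^ 2 ≤ M) :
    ∑ j ∈ s, ⟪a j, e⟫ ^ 2 ≤ M * ∑ j ∈ s, ‖a j‖ ^ 2 := by
  rw [Finset.mul_sum]
  refine Finset.sum_le_sum fun j _ => ?_
  have hn : 0 < ‖a j‖ := norm_pos_iff.mpr (ha j)
  exact (div_le_iff₀ (by positivity)).mp (hM j)

end Kaczmarz

/-- deterministic linear convergence of the original GRK method, with rate
`(1 - ½(‖A‖_F²/γ + 1)·σ²/‖A‖_F²)^(k-1) (1 - σ²/‖A‖_F²)` where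
`γ = max_{i∈[m]} ∑_{j≠i} ‖a_j‖₂²`.  The greedy set `I_k` uses the threshold `‖A‖_F²`.
The projection `xs = A†b + (I - A†A)x⁰` is encoded by `⟪a i, xs⟫ = b i` and
`x 0 - xs ∈ Range(Aᵀ) = span {a₁,…,a_m}`, and the smallest nonzero singular value `σ`
by `σ > 0` and `σ²‖z‖² ≤ ∑ i ⟪a i, z⟫²` for `z ∈ Range(Aᵀ)`. -/
theorem GRK_deterministic_linear_convergence {m n : ℕ} [Nonempty (Fin m)] (hm : 2 ≤ m)
    (a : Fin m → EuclideanSpace ℝ (Fin n)) (b : Fin m → ℝ)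
    (ha : ∀ i, a i ≠ 0)
    (xs : EuclideanSpace ℝ (Fin n)) (hxs : ∀ i, ⟪a i, xs⟫ = b i)
    (σ : ℝ) (hσpos : 0 < σ)
    (hσ : ∀ z ∈ Submodule.span ℝ (Set.range a), σ ^ 2 * ‖z‖ ^ 2 ≤ ∑ i, ⟪a i, z⟫ ^ 2)
    (x : ℕ → EuclideanSpace ℝ (Fin n))
    (hx0 : x 0 - xs ∈ Submodule.span ℝ (Set.range a))
    (idx : ℕ → Fin m)
    (hne : ∀ k : ℕ, ∃ i, ⟪a i, x k⟫ ≠ b i)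
    (hik : ∀ k : ℕ,
      (⟪a (idx k), x k⟫ - b (idx k)) ^ 2 / ‖a (idx k)‖ ^ 2 ≥
        (1 / 2) *
          ((Finset.univ.sup' Finset.univ_nonempty fun j => (⟪a j, x k⟫ - b j) ^ 2 / ‖a j‖ ^ 2) +
            (∑ j, (⟪a j, x k⟫ - b j) ^ 2) / ∑ j, ‖a j‖ ^ 2))
    (hrec : ∀ k : ℕ,
      x (k + 1) = x k - ((⟪a (idx k), x k⟫ - b (idx k)) / ‖a (idx k)‖ ^ 2) • a (idx k)) :
    ∀ k : ℕ, 1 ≤ k →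
      ‖x k - xs‖ ^ 2 ≤
        (1 - (1 / 2) * ((∑ j, ‖a j‖ ^ 2) / (Finset.univ.sup' Finset.univ_nonempty fun i =>
              ∑ j ∈ Finset.univ.erase i, ‖a j‖ ^ 2) + 1) * (σ ^ 2 / ∑ j, ‖a j‖ ^ 2)) ^ (k - 1) *
          ((1 - σ ^ 2 / ∑ j, ‖a j‖ ^ 2) * ‖x 0 - xs‖ ^ 2) := by
  set F : ℝ := ∑ j, ‖a j‖ ^ 2 with hF
  set γ : ℝ := Finset.univ.sup' Finset.univ_nonempty fun i =>
    ∑ j ∈ Finset.univ.erase i, ‖a j‖ ^ 2 with hγ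
  set q : ℝ := 1 - (1 / 2) * (F / γ + 1) * (σ ^ 2 / F) with hq
  have hFpos : 0 < F := Finset.sum_pos
    (fun j _ => pow_pos (norm_pos_iff.mpr (ha j)) 2) Finset.univ_nonempty
  have hγle : ∀ i, ∑ j ∈ Finset.univ.erase i, ‖a j‖ ^ 2 ≤ γ := fun i =>
    Finset.le_sup' (fun i => ∑ j ∈ Finset.univ.erase i, ‖a j‖ ^ 2) (Finset.mem_univ i)
  have hγ0 : 0 ≤ γ := (Finset.sum_nonneg fun _ _ => sq_nonneg _).trans (hγle (idx 0))
  have hres : ∀ k j, ⟪a j, x k⟫ - b j = ⟪a j, x k - xs⟫ := fun k j => by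
    rw [inner_sub_right, hxs]
  simp only [hres] at hik hrec
  have herr : ∀ k, x (k + 1) - xs = (x k - xs) -
      (⟪a (idx k), x k - xs⟫ / ‖a (idx k)‖ ^ 2) • a (idx k) := fun k => by
    rw [hrec k]; abel
  have hspan : ∀ k, x k - xs ∈ Submodule.span ℝ (Set.range a) := fun k => by
    induction k with
    | zero => exact hx0
    | succ k ih =>
      rw [herr k]
      exact sub_mem ih (Submodule.smul_mem _ _ (Submodule.subset_span ⟨idx k, rfl⟩))
  have hdecr : ∀ k c, (∀ M, (∀ j, ⟪a j, x k - xs⟫ ^ 2 / ‖a j‖ ^ 2 ≤ M) →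
      (∑ j, ⟪a j, x k - xs⟫ ^ 2) / c ≤ M) →
      0 ≤ c → ‖x (k + 1) - xs‖ ^ 2 ≤
        (1 - (1 / 2) * (F / c + 1) * (σ ^ 2 / F)) * ‖x k - xs‖ ^ 2 := by
    intro k c hc hc0
    have hM := hc (Finset.univ.sup' Finset.univ_nonempty fun j => ⟪a j, x k - xs⟫ ^ 2 / ‖a j‖ ^ 2)
      fun j => Finset.le_sup' (fun j => ⟪a j, x k - xs⟫ ^ 2 / ‖a j‖ ^ 2) (Finset.mem_univ j)
    have hi := hik k
    have hR := hσ _ (hspan k)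
    have h1 := div_le_div_of_nonneg_right hR hc0
    have h2 := div_le_div_of_nonneg_right hR hFpos.le
    have h3 : (1 - (1 / 2) * (F / c + 1) * (σ ^ 2 / F)) * ‖x k - xs‖ ^ 2 = ‖x k - xs‖ ^ 2 -
        (1 / 2) * (σ ^ 2 * ‖x k - xs‖ ^ 2 / c + σ ^ 2 * ‖x k - xs‖ ^ 2 / F) := by
      have : F / c * (σ ^ 2 / F) = σ ^ 2 / c := by
        rw [div_mul_div_comm, mul_comm c F, mul_div_mul_left _ _ hFpos.ne']
      linear_combination (-(1 / 2) * ‖x k - xs‖ ^ 2) * this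
    rw [h3, herr k, norm_sub_smul_inner_div_sq]
    linarith
  have hfirst : ‖x 1 - xs‖ ^ 2 ≤ (1 - σ ^ 2 / F) * ‖x 0 - xs‖ ^ 2 := by
    have h := hdecr 0 F (fun M hM => (div_le_iff₀ hFpos).mpr
      (sum_inner_sq_le_mul_sum_norm_sq a ha _ _ hM)) hFpos.le
    rw [div_self hFpos.ne'] at h
    norm_num at h
    exact h
  have hstep : ∀ k, ‖x (k + 2) - xs‖ ^ 2 ≤ q * ‖x (k + 1) - xs‖ ^ 2 := by
    intro k
    refine hdecr (k + 1) γ (fun M hM => ?_) hγ0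
    have hM0 : 0 ≤ M := le_trans (by positivity) (hM (idx 0))
    refine div_le_of_le_mul₀ hγ0 hM0 ?_
    have hzero : ⟪a (idx k), x (k + 1) - xs⟫ = 0 := by
      rw [herr k, inner_sub_smul_inner_div]
    rw [← Finset.add_sum_erase _ _ (Finset.mem_univ (idx k)), hzero]
    calc (0 : ℝ) ^ 2 + ∑ j ∈ Finset.univ.erase (idx k), ⟪a j, x (k + 1) - xs⟫ ^ 2
        ≤ M * ∑ j ∈ Finset.univ.erase (idx k), ‖a j‖ ^ 2 := by
          rw [zero_pow two_ne_zero, zero_add]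
          exact sum_inner_sq_le_mul_sum_norm_sq a ha _ _ hM
      _ ≤ M * γ := mul_le_mul_of_nonneg_left (hγle _) hM0
  have hq0 : 0 ≤ q := by
    obtain ⟨i, hi⟩ := hne 1
    have hpos : 0 < ‖x 1 - xs‖ ^ 2 := by
      refine pow_pos (norm_pos_iff.mpr fun h => hi ?_) 2
      rw [sub_eq_zero.mp h, hxs]
    exact nonneg_of_mul_nonneg_left ((sq_nonneg _).trans (hstep 0)) hpos
  intro k hk
  induction k, hk using Nat.le_induction with
  | base => simpa using hfirst
  | succ k hk ih =>
    obtain ⟨k, rfl⟩ := Nat.exists_eq_add_of_le' hk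
    refine (hstep k).trans ((mul_le_mul_of_nonneg_left ih hq0).trans_eq ?_)
    simp only [Nat.add_sub_cancel]
    ring
end

section
/- (Lemma 2.3, high-probability complexity from conditional contraction.) Let (Ω, F, P) be a probability space with a filtration (F_k)_{k≥0}, and let (ξ_k)_{k≥0} be a sequence of nonnegative real random variables with ξ_k F_k-measurable, ξ_0 a (deterministic) constant, and ξ_{k+1} ≤ ξ_k almost surely for all k. Choose an accuracy 0 < ε < ξ_0, a confidence level ρ ∈ (0,1), and a constant c > 1, and assume that almost surely on the event {ξ_k ≥ ε} one has E[ξ_{k+1} | F_k] ≤ (1 − 1/c)·ξ_k, for every k ≥ 0. Then for every integer K ≥ c · log(ξ_0/(ε·ρ)), P(ξ_K ≤ ε) ≥ 1 − ρ. -/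
open MeasureTheory

/-- If `0 ≤ Y ≤ X` and the conditional expectation of `Y` is at most `q * X` on `{ε ≤ X}`, then
the integrals over the superlevel sets contract by the factor `q`. -/
lemma setIntegral_superlevel_le_mul_of_condExp_le
    {Ω : Type*} {m m0 : MeasurableSpace Ω} (hm : m ≤ m0) {μ : Measure Ω} [IsFiniteMeasure μ]
    {X Y : Ω → ℝ} (hXm : Measurable[m] X) (hX : Integrable X μ) (hY : Integrable Y μ)
    (hY0 : 0 ≤ᵐ[μ] Y) (hYX : Y ≤ᵐ[μ] X) {ε q : ℝ}
    (hcond : ∀ᵐ ω ∂μ, ε ≤ X ω → (μ[Y | m]) ω ≤ q * X ω) :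
    ∫ ω in {ω | ε ≤ Y ω}, Y ω ∂μ ≤ q * ∫ ω in {ω | ε ≤ X ω}, X ω ∂μ := by
  have hS : MeasurableSet[m] {ω | ε ≤ X ω} := measurableSet_le measurable_const hXm
  calc ∫ ω in {ω | ε ≤ Y ω}, Y ω ∂μ
      ≤ ∫ ω in {ω | ε ≤ X ω}, Y ω ∂μ := by
        refine setIntegral_mono_set hY.integrableOn (ae_restrict_of_ae hY0) ?_
        filter_upwards [hYX] with ω hω (h : ε ≤ Y ω) using h.trans hω
    _ = ∫ ω in {ω | ε ≤ X ω}, (μ[Y | m]) ω ∂μ := (setIntegral_condExp hm hY hS).symm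
    _ ≤ ∫ ω in {ω | ε ≤ X ω}, q * X ω ∂μ :=
        setIntegral_mono_on_ae integrable_condExp.integrableOn (hX.const_mul q).integrableOn
          (hm _ hS) hcond
    _ = q * ∫ ω in {ω | ε ≤ X ω}, X ω ∂μ := integral_const_mul _ _

/-- After `c * log (a / b)` steps, contraction by the factor `1 - 1 / c` brings `a` below `b`. -/
lemma one_sub_inv_pow_mul_le_of_log_le {a b c : ℝ} (ha : 0 < a) (hb : 0 < b) (hc : 1 < c)
    {K : ℕ} (hK : c * Real.log (a / b) ≤ K) : (1 - 1 / c) ^ K * a ≤ b := by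
  have hc0 : 0 < c := one_pos.trans hc
  have hq : 0 ≤ 1 - 1 / c := sub_nonneg.2 ((div_le_one hc0).2 hc.le)
  have hlog : Real.log (a / b) ≤ K / c := by rwa [le_div_iff₀' hc0]
  calc (1 - 1 / c) ^ K * a ≤ Real.exp (-(1 / c)) ^ K * a := by
        gcongr
        exact Real.one_sub_le_exp_neg _
    _ = Real.exp (-(K / c)) * a := by
        rw [← Real.exp_nat_mul]
        congr 2
        ring
    _ ≤ Real.exp (-Real.log (a / b)) * a := by gcongr
    _ = b := by
        rw [Real.exp_neg, Real.exp_log (div_pos ha hb)]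
        field_simp

/-- Lemma 2.3: high-probability iteration complexity from a conditional
contraction.  `(ξ_k)` is a nonincreasing sequence of nonnegative random variables adapted
to the filtration `(F_k)`, `ξ_0` is a deterministic constant, and almost surely on the
event `{ξ_k ≥ ε}` one has `E[ξ_{k+1} | F_k] ≤ (1 - 1/c) ξ_k`.  Then for every
`K ≥ c·log(ξ_0/(ε ρ))`, `P(ξ_K ≤ ε) ≥ 1 - ρ`. -/
theorem high_probability_complexity_from_conditional_contraction
    {Ω : Type*} {m0 : MeasurableSpace Ω} (μ : Measure Ω) [IsProbabilityMeasure μ]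
    (F : Filtration ℕ m0)
    (ξ : ℕ → Ω → ℝ)
    (hadapt : Adapted F ξ)
    (hnonneg : ∀ k, ∀ᵐ ω ∂μ, 0 ≤ ξ k ω)
    (ξ0 : ℝ) (hξ0 : ∀ ω, ξ 0 ω = ξ0)
    (hmono : ∀ k, ∀ᵐ ω ∂μ, ξ (k + 1) ω ≤ ξ k ω)
    (ε ρ c : ℝ) (hε : 0 < ε) (hεξ0 : ε < ξ0) (hρ0 : 0 < ρ) (hρ1 : ρ < 1) (hc : 1 < c)
    (hcond : ∀ k, ∀ᵐ ω ∂μ, ε ≤ ξ k ω → (μ[ξ (k + 1) | F k]) ω ≤ (1 - 1 / c) * ξ k ω) :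
    ∀ K : ℕ, c * Real.log (ξ0 / (ε * ρ)) ≤ (K : ℝ) →
      ENNReal.ofReal (1 - ρ) ≤ μ {ω | ξ K ω ≤ ε} := by
  intro K hK
  have hmeas : ∀ k, Measurable (ξ k) := fun k => (hadapt k).mono (F.le k) le_rfl
  have hbdd : ∀ k, ∀ᵐ ω ∂μ, ξ k ω ≤ ξ0 := by
    intro k
    induction k with
    | zero => exact ae_of_all _ fun ω => (hξ0 ω).le
    | succ k ih => filter_upwards [ih, hmono k] with ω h₁ h₂ using h₂.trans h₁
  have hint : ∀ k, Integrable (ξ k) μ := by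
    intro k
    refine Integrable.of_bound (hmeas k).aestronglyMeasurable ξ0 ?_
    filter_upwards [hnonneg k, hbdd k] with ω h₁ h₂
    rwa [Real.norm_of_nonneg h₁]
  have hq : 0 ≤ 1 - 1 / c := sub_nonneg.2 ((div_le_one (one_pos.trans hc)).2 hc.le)
  have hdecay : ∀ k, ∫ ω in {ω | ε ≤ ξ k ω}, ξ k ω ∂μ ≤ (1 - 1 / c) ^ k * ξ0 := by
    intro k
    induction k with
    | zero => simp [hξ0, hεξ0.le]
    | succ k ih =>
      refine (setIntegral_superlevel_le_mul_of_condExp_le (F.le k) (hadapt k) (hint k)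
        (hint (k + 1)) (hnonneg (k + 1)) (hmono k) (hcond k)).trans ?_
      rw [pow_succ', mul_assoc]
      exact mul_le_mul_of_nonneg_left ih hq
  have hS : MeasurableSet {ω | ε ≤ ξ K ω} := measurableSet_le measurable_const (hmeas K)
  have hmarkov : ε * μ.real {ω | ε ≤ ξ K ω} ≤ ε * ρ :=
    calc ε * μ.real {ω | ε ≤ ξ K ω}
        ≤ ∫ ω in {ω | ε ≤ ξ K ω}, ξ K ω ∂μ :=
          setIntegral_ge_of_const_le_real hS (measure_ne_top _ _) (fun _ h => h)
            (hint K).integrableOn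
      _ ≤ (1 - 1 / c) ^ K * ξ0 := hdecay K
      _ ≤ ε * ρ :=
          one_sub_inv_pow_mul_le_of_log_le (hε.trans hεξ0) (mul_pos hε hρ0) hc hK
  have hρ : μ.real {ω | ε ≤ ξ K ω} ≤ ρ := le_of_mul_le_mul_left hmarkov hε
  have hcompl : {ω | ε ≤ ξ K ω}ᶜ ⊆ {ω | ξ K ω ≤ ε} := fun ω (h : ¬ε ≤ ξ K ω) => (not_le.1 h).le
  refine ENNReal.ofReal_le_of_le_toReal ?_
  calc 1 - ρ ≤ 1 - μ.real {ω | ε ≤ ξ K ω} := by gcongr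
    _ = μ.real {ω | ε ≤ ξ K ω}ᶜ := (probReal_compl_eq_one_sub hS).symm
    _ ≤ μ.real {ω | ξ K ω ≤ ε} := measureReal_mono hcompl
end

section
/- (Lemma 3.1, two-term recurrence bound.) Let (F_k)_{k≥0} be a sequence of nonnegative real numbers with F_1 = F_0 ≥ 0 satisfying F_{k+1} ≤ γ₁ F_k + γ₂ F_{k−1} for all k ≥ 1, where γ₂ ≥ 0, γ₁ + γ₂ < 1, and additionally γ₁ ≥ 0 if γ₂ = 0. Define q = (γ₁ + √(γ₁² + 4γ₂))/2 if γ₂ > 0 and q = γ₁ if γ₂ = 0, and δ = q − γ₁. Then δ ≥ 0, γ₁ + γ₂ ≤ q < 1 (with q = γ₁ + γ₂ if and only if γ₂ = 0), and F_{k+1} ≤ q^k (1 + δ) F_0 for all k ≥ 0. -/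
/-- Lemma 3.1: two-term recurrence bound.  If `F₁ = F₀ ≥ 0`,
`F_{k+1} ≤ γ₁ F_k + γ₂ F_{k-1}` for all `k ≥ 1`, with `γ₂ ≥ 0`, `γ₁ + γ₂ < 1`
(and `γ₁ ≥ 0` in the degenerate case `γ₂ = 0`), then with
`q = (γ₁ + √(γ₁² + 4γ₂))/2` if `γ₂ > 0`, `q = γ₁` if `γ₂ = 0`, and `δ = q - γ₁`:
`δ ≥ 0`, `γ₁ + γ₂ ≤ q < 1` with equality iff `γ₂ = 0`, and
`F_{k+1} ≤ q^k (1 + δ) F₀` for all `k ≥ 0`. -/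
theorem two_term_recurrence_bound (γ1 γ2 : ℝ)
    (hγ2 : 0 ≤ γ2) (hsum : γ1 + γ2 < 1) (hγ1 : γ2 = 0 → 0 ≤ γ1)
    (F : ℕ → ℝ) (hFnonneg : ∀ k, 0 ≤ F k) (hF1 : F 1 = F 0)
    (hrec : ∀ k : ℕ, 1 ≤ k → F (k + 1) ≤ γ1 * F k + γ2 * F (k - 1))
    (q δ : ℝ)
    (hq : (0 < γ2 → q = (γ1 + Real.sqrt (γ1 ^ 2 + 4 * γ2)) / 2) ∧ (γ2 = 0 → q = γ1))
    (hδ : δ = q - γ1) :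
    0 ≤ δ ∧ γ1 + γ2 ≤ q ∧ q < 1 ∧ (q = γ1 + γ2 ↔ γ2 = 0) ∧
      ∀ k : ℕ, F (k + 1) ≤ q ^ k * (1 + δ) * F 0 := by
  have key : 0 ≤ q ∧ 0 ≤ δ ∧ q * δ = γ2 ∧ (γ2 ≠ 0 → 0 < δ) := by
    rcases hγ2.eq_or_lt with h | h
    · have hq0 := hq.2 h.symm
      have hδ0 : δ = 0 := by rw [hδ, hq0, sub_self]
      exact ⟨hq0 ▸ hγ1 h.symm, hδ0.ge, by rw [hδ0, mul_zero, h], fun h' => absurd h.symm h'⟩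
    · have hq0 := hq.1 h
      have hlt : |γ1| < √(γ1 ^ 2 + 4 * γ2) := by
        rw [← Real.sqrt_sq_eq_abs]
        exact Real.sqrt_lt_sqrt (sq_nonneg _) (by linarith)
      have hsq : √(γ1 ^ 2 + 4 * γ2) ^ 2 = γ1 ^ 2 + 4 * γ2 := Real.sq_sqrt (by positivity)
      have hle := le_abs_self γ1
      have hneg := neg_abs_le γ1
      have hδpos : 0 < δ := by linarith
      refine ⟨by linarith, hδpos.le, ?_, fun _ => hδpos⟩
      rw [hδ, hq0]
      linear_combination hsq / 4
  obtain ⟨hq0, hδ0, hmul, hδpos⟩ := key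
  have hq1 : q < 1 := by
    have hfactor : 0 < (1 - q) * (1 + δ) := by linarith
    linarith [pos_of_mul_pos_left hfactor (by linarith)]
  have hgap : q - (γ1 + γ2) = δ * (1 - q) := by linear_combination hmul - hδ
  refine ⟨hδ0, ?_, hq1, ⟨fun h => ?_, fun h => ?_⟩, fun k => ?_⟩
  · linarith [mul_nonneg hδ0 (sub_nonneg.2 hq1.le)]
  · by_contra hne
    linarith [mul_pos (hδpos hne) (sub_pos.2 hq1)]
  · rw [hq.2 h, h, add_zero]
  · have hlyapunov : F (k + 1) + δ * F k ≤ q ^ k * (1 + δ) * F 0 := by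
      induction k with
      | zero => rw [hF1]; linarith
      | succ k ih =>
        have hstep := hrec (k + 1) (Nat.le_add_left 1 k)
        rw [Nat.add_sub_cancel] at hstep
        calc F (k + 1 + 1) + δ * F (k + 1)
            ≤ γ1 * F (k + 1) + γ2 * F k + δ * F (k + 1) := by gcongr
          _ = q * (F (k + 1) + δ * F k) := by
            linear_combination F (k + 1) * hδ - F k * hmul
          _ ≤ q * (q ^ k * (1 + δ) * F 0) := by gcongr
          _ = q ^ (k + 1) * (1 + δ) * F 0 := by ring
    exact (le_add_of_nonneg_right (mul_nonneg hδ0 (hFnonneg k))).trans hlyapunov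
end

section
/- (Key one-step inequality for the heavy-ball Kaczmarz update.) Let a ∈ ℝⁿ be nonzero and P = a aᵀ/‖a‖₂² be the orthogonal projection onto span{a}. Let α ≥ 0 and β ≥ 0 satisfy β² + β − αβ ≥ 0 (i.e., α ≤ 1 + β or β = 0). Then for all x, y, x* ∈ ℝⁿ, the point x⁺ = x − α·P(x − x*) + β(x − y) satisfies ‖x⁺ − x*‖₂² ≤ (2β² + 3β + 1)·‖x − x*‖₂² + (2β² + β)·‖y − x*‖₂² − (3αβ + 2α − α²)·‖P(x − x*)‖₂². -/
open scoped RealInnerProductSpace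

/-- key one-step inequality for the heavy-ball Kaczmarz update.
For nonzero `a`, `P = a aᵀ/‖a‖²` is the orthogonal projection onto `span{a}`, so that
`P z = (⟪a, z⟫/‖a‖²) • a`.  For `α, β ≥ 0` with `β² + β - αβ ≥ 0`, the heavy-ball
update `x⁺ = x - α • P(x - xs) + β • (x - y)` satisfies
`‖x⁺ - xs‖² ≤ (2β² + 3β + 1)‖x - xs‖² + (2β² + β)‖y - xs‖² - (3αβ + 2α - α²)‖P(x - xs)‖²`. -/
theorem heavy_ball_kaczmarz_one_step {n : ℕ}
    (a : EuclideanSpace ℝ (Fin n)) (ha : a ≠ 0)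
    (α β : ℝ) (hα : 0 ≤ α) (hβ : 0 ≤ β) (hαβ : 0 ≤ β ^ 2 + β - α * β)
    (x y xs : EuclideanSpace ℝ (Fin n)) :
    ‖(x - α • ((⟪a, x - xs⟫ / ‖a‖ ^ 2) • a) + β • (x - y)) - xs‖ ^ 2 ≤
      (2 * β ^ 2 + 3 * β + 1) * ‖x - xs‖ ^ 2 + (2 * β ^ 2 + β) * ‖y - xs‖ ^ 2 -
        (3 * α * β + 2 * α - α ^ 2) * ‖(⟪a, x - xs⟫ / ‖a‖ ^ 2) • a‖ ^ 2 := by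
  have hN : 0 < ‖a‖ ^ 2 := by positivity
  obtain ⟨u, hu⟩ : ∃ u, u = x - xs := ⟨_, rfl⟩
  obtain ⟨v, hv⟩ : ∃ v, v = y - xs := ⟨_, rfl⟩
  obtain ⟨c, hc⟩ : ∃ c, c = ⟪a, u⟫ / ‖a‖ ^ 2 := ⟨_, rfl⟩
  obtain ⟨d, hd⟩ : ∃ d, d = ⟪a, v⟫ / ‖a‖ ^ 2 := ⟨_, rfl⟩
  have hs : ⟪a, u⟫ = c * ‖a‖ ^ 2 := by rw [hc]; field_simp
  have ht : ⟪a, v⟫ = d * ‖a‖ ^ 2 := by rw [hd]; field_simp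
  have hstep : (x - α • (c • a) + β • (x - y)) - xs = (1 + β) • u - (α * c) • a - β • v := by
    rw [hu, hv]; module
  rw [← hu, ← hv, ← hc, hstep]
  have hnorm : ‖(1 + β) • u - (α * c) • a - β • v‖ ^ 2 =
      (1 + β) ^ 2 * ‖u‖ ^ 2 + (α * c) ^ 2 * ‖a‖ ^ 2 + β ^ 2 * ‖v‖ ^ 2
        - 2 * (1 + β) * (α * c) * ⟪a, u⟫ - 2 * β * (1 + β) * ⟪u, v⟫
        + 2 * (α * c) * β * ⟪a, v⟫ := by
    simp only [norm_sub_sq_real, inner_sub_left, real_inner_smul_left, real_inner_smul_right,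
      norm_smul, mul_pow, Real.norm_eq_abs, sq_abs, real_inner_comm a u]
    ring
  have hsum : ‖u + v‖ ^ 2 = ‖u‖ ^ 2 + 2 * ⟪u, v⟫ + ‖v‖ ^ 2 := norm_add_sq_real u v
  have hca : ‖c • a‖ ^ 2 = c ^ 2 * ‖a‖ ^ 2 := by
    rw [norm_smul, mul_pow, Real.norm_eq_abs, sq_abs]
  -- The projection of `u + v` onto the span of `a` is no longer than `u + v`.
  have hproj : (c + d) ^ 2 * ‖a‖ ^ 2 ≤ ‖u + v‖ ^ 2 := by
    have h : 0 ≤ ‖(u + v) - (c + d) • a‖ ^ 2 := by positivity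
    rw [norm_sub_sq_real, real_inner_smul_right, real_inner_comm, inner_add_right, hs, ht,
      norm_smul, mul_pow, Real.norm_eq_abs, sq_abs] at h
    linarith
  have h₁ : (β ^ 2 + β) * ((c + d) ^ 2 * ‖a‖ ^ 2) ≤ (β ^ 2 + β) * ‖u + v‖ ^ 2 := by gcongr
  have h₂ : 0 ≤ (β ^ 2 + β - α * β) * ((c + d) ^ 2 * ‖a‖ ^ 2) := by positivity
  have h₃ : 0 ≤ α * β * (d ^ 2 * ‖a‖ ^ 2) := by positivity
  rw [hsum] at h₁
  rw [hnorm, hs, ht, hca]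
  linarith
end

section
/- (Theorem 3.2, deterministic linear convergence of mGRK.) Let A ∈ ℝ^{m×n} have nonzero rows, let Ax = b be consistent, x⁰ = x^{−1} ∈ ℝⁿ, x* = A†b + (I − A†A)x⁰, and θ ∈ [0,1]. Assume α ∈ (0,2) if β = 0 and α ∈ (0, 1+β) if β > 0, and that γ₁ = 2β² + 3β + 1 − (3αβ + 2α − α²)·σ_min²(A)/‖A‖_F² and γ₂ = 2β² + β satisfy γ₁ + γ₂ < 1. Let (x^k) be generated by the mGRK iteration: at each step Ax^k ≠ b, Γ_k = Γ(x^k), an arbitrary index i_k is chosen from S_k = {i : |⟨a_i,x^k⟩ − b_i|²/‖a_i‖₂² ≥ θ·max_{j∈[m]} |⟨a_j,x^k⟩ − b_j|²/‖a_j‖₂² + (1−θ)·‖Ax^k − b‖₂²/Γ_k}, and x^{k+1} = x^k − α((⟨a_{i_k},x^k⟩ − b_{i_k})/‖a_{i_k}‖₂²)a_{i_k} + β(x^k − x^{k−1}). Then, regardless of the choices of i_k ∈ S_k, for all k ≥ 0, ‖x^{k+1} − x*‖₂² ≤ q^k (1 + δ) ‖x⁰ − x*‖₂², where q = (γ₁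 + √(γ₁² + 4γ₂))/2 if γ₂ > 0, q = γ₁ if γ₂ = 0, and δ = q − γ₁; moreover γ₁ + γ₂ ≤ q < 1. -/
open scoped RealInnerProductSpace BigOperators

/-- One relaxed projection step along `v` with momentum, measured relative to a point of the
hyperplane: `e` and `e'` are the current and the previous errors. -/
theorem norm_sq_momentum_step_le {E : Type*} [NormedAddCommGroup E] [InnerProductSpace ℝ E]
    {v : E} (hv : v ≠ 0) (e e' : E) {α β : ℝ} (hα : 0 ≤ α) (hβ : 0 ≤ β)
    (hαβ : 0 < β → α ≤ 1 + β) :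
    ‖e - α • ((⟪v, e⟫ / ‖v‖ ^ 2) • v) + β • (e - e')‖ ^ 2 ≤
      (2 * β ^ 2 + 3 * β + 1) * ‖e‖ ^ 2 + (2 * β ^ 2 + β) * ‖e'‖ ^ 2 -
        (3 * α * β + 2 * α - α ^ 2) * (⟪v, e⟫ ^ 2 / ‖v‖ ^ 2) := by
  have hV : 0 < ‖v‖ ^ 2 := by positivity
  have hcs : (⟪v, e⟫ + ⟪v, e'⟫) ^ 2 / ‖v‖ ^ 2 ≤ ‖e‖ ^ 2 + 2 * ⟪e, e'⟫ + ‖e'‖ ^ 2 := by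
    rw [div_le_iff₀ hV, ← inner_add_right, ← norm_add_sq_real, ← mul_pow, mul_comm]
    exact sq_le_sq.mpr (by simpa [abs_mul] using abs_real_inner_le_norm v (e + e'))
  have hexp : ‖e - α • ((⟪v, e⟫ / ‖v‖ ^ 2) • v) + β • (e - e')‖ ^ 2 =
      (1 + β) ^ 2 * ‖e‖ ^ 2 - 2 * β * (1 + β) * ⟪e, e'⟫ + β ^ 2 * ‖e'‖ ^ 2
        - 2 * α * (1 + β) * (⟪v, e⟫ ^ 2 / ‖v‖ ^ 2) + α ^ 2 * (⟪v, e⟫ ^ 2 / ‖v‖ ^ 2)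
        + 2 * α * β * (⟪v, e⟫ * ⟪v, e'⟫ / ‖v‖ ^ 2) := by
    simp only [← real_inner_self_eq_norm_sq] at hV ⊢
    simp only [inner_add_left, inner_add_right, inner_sub_left, inner_sub_right,
      real_inner_smul_left, real_inner_smul_right, real_inner_comm v e, real_inner_comm v e',
      real_inner_comm e e']
    field_simp
    ring
  have hsplit : (⟪v, e⟫ + ⟪v, e'⟫) ^ 2 / ‖v‖ ^ 2 = ⟪v, e⟫ ^ 2 / ‖v‖ ^ 2 +
      2 * (⟪v, e⟫ * ⟪v, e'⟫ / ‖v‖ ^ 2) + ⟪v, e'⟫ ^ 2 / ‖v‖ ^ 2 := by ring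
  have hp' : 0 ≤ ⟪v, e'⟫ ^ 2 / ‖v‖ ^ 2 := by positivity
  have hs : 0 ≤ (⟪v, e⟫ + ⟪v, e'⟫) ^ 2 / ‖v‖ ^ 2 := by positivity
  rw [hexp]
  rcases hβ.eq_or_lt with rfl | hβ'
  · linarith
  have h₁ := mul_le_mul_of_nonneg_left hcs (by positivity : 0 ≤ β * (1 + β))
  have h₂ := mul_le_mul_of_nonneg_right (mul_le_mul_of_nonneg_left (hαβ hβ') hβ) hs
  have h₃ := mul_nonneg (mul_nonneg hα hβ) hp'
  rw [hsplit] at h₁ h₂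
  linarith

/-- Every index of the relaxed greedy set has squared distance at least the average
`‖r‖² / ∑ w`, where `r` is the residual and `w` the squared row norms. -/
theorem sum_sq_div_sum_le_greedy_threshold {ι : Type*} [Fintype ι] [Nonempty ι]
    (r w : ι → ℝ) (hw : ∀ i, 0 < w i) (hr : ∃ i, r i ≠ 0) {θ : ℝ} (hθ0 : 0 ≤ θ) (hθ1 : θ ≤ 1)
    (s : Finset ι) (hs : ∀ i, i ∈ s ↔ r i ≠ 0) :
    (∑ i, r i ^ 2) / ∑ i, w i ≤
      θ * (Finset.univ.sup' Finset.univ_nonempty fun i => r i ^ 2 / w i) +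
        (1 - θ) * ((∑ i, r i ^ 2) / ∑ i ∈ s, w i) := by
  have hW : 0 < ∑ i, w i := Finset.sum_pos (fun i _ => hw i) Finset.univ_nonempty
  obtain ⟨i₀, hi₀⟩ := hr
  have hΓ : 0 < ∑ i ∈ s, w i := Finset.sum_pos (fun i _ => hw i) ⟨i₀, (hs i₀).2 hi₀⟩
  have hΓW : ∑ i ∈ s, w i ≤ ∑ i, w i :=
    Finset.sum_le_sum_of_subset_of_nonneg (Finset.subset_univ s) fun i _ _ => (hw i).le
  have hmax : (∑ i, r i ^ 2) / ∑ i, w i ≤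
      Finset.univ.sup' Finset.univ_nonempty fun i => r i ^ 2 / w i := by
    rw [div_le_iff₀ hW, Finset.mul_sum]
    refine Finset.sum_le_sum fun i _ => ?_
    rw [← div_le_iff₀ (hw i)]
    exact Finset.le_sup' (fun i => r i ^ 2 / w i) (Finset.mem_univ i)
  have havg : (∑ i, r i ^ 2) / ∑ i, w i ≤ (∑ i, r i ^ 2) / ∑ i ∈ s, w i :=
    div_le_div_of_nonneg_left (Finset.sum_nonneg fun i _ => sq_nonneg (r i)) hΓ hΓW
  have h₁ := mul_le_mul_of_nonneg_left hmax hθ0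
  have h₂ := mul_le_mul_of_nonneg_left havg (sub_nonneg.2 hθ1)
  linarith

/-- The nonnegative root `q` of `t² = γ₁ t + γ₂` when `γ₁ + γ₂ < 1`. -/
theorem quadratic_root_bounds {γ1 γ2 : ℝ} (hγ2 : 0 < γ2) (hsum : γ1 + γ2 < 1) {q : ℝ}
    (hq : q = (γ1 + Real.sqrt (γ1 ^ 2 + 4 * γ2)) / 2) :
    γ1 + γ2 ≤ q ∧ q < 1 ∧ 0 ≤ q ∧ 0 ≤ q - γ1 ∧ q * (q - γ1) = γ2 := by
  have hD : 0 ≤ γ1 ^ 2 + 4 * γ2 := by positivity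
  have hsq := Real.sq_sqrt hD
  have habs : |γ1| ≤ Real.sqrt (γ1 ^ 2 + 4 * γ2) := Real.abs_le_sqrt (by linarith)
  have hlow : γ1 + 2 * γ2 ≤ Real.sqrt (γ1 ^ 2 + 4 * γ2) := Real.le_sqrt_of_sq_le (by nlinarith)
  have hup : Real.sqrt (γ1 ^ 2 + 4 * γ2) < 2 - γ1 :=
    (Real.sqrt_lt' (by linarith)).2 (by nlinarith)
  obtain ⟨h₁, h₂⟩ := abs_le.1 habs
  subst hq
  refine ⟨by linarith, by linarith, by linarith, by linarith, ?_⟩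
  nlinarith

/-- Linear decay of a nonnegative sequence with a two-term recursive bound, where the term
before the first is taken equal to the first (by truncated subtraction). -/
theorem two_term_recursion_le {F : ℕ → ℝ} (hF : ∀ k, 0 ≤ F k) {γ1 γ2 q : ℝ}
    (hrec : ∀ k, F (k + 1) ≤ γ1 * F k + γ2 * F (k - 1))
    (hq0 : 0 ≤ q) (hq1 : q ≤ 1) (hδ : 0 ≤ q - γ1) (hroot : q * (q - γ1) = γ2) (k : ℕ) :
    F (k + 1) ≤ q ^ k * (1 + (q - γ1)) * F 0 := by
  have step : ∀ k, F (k + 1) + (q - γ1) * F k ≤ q * (F k + (q - γ1) * F (k - 1)) := fun k => by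
    have := hrec k
    rw [← hroot] at this
    linarith
  have main : ∀ k, F (k + 1) + (q - γ1) * F k ≤ q ^ (k + 1) * ((1 + (q - γ1)) * F 0) := by
    intro k
    induction k with
    | zero => simpa [add_mul] using step 0
    | succ k ih =>
      calc _ ≤ q * (F (k + 1) + (q - γ1) * F k) := step (k + 1)
        _ ≤ q * (q ^ (k + 1) * ((1 + (q - γ1)) * F 0)) := mul_le_mul_of_nonneg_left ih hq0
        _ = _ := by ring
  have hC : 0 ≤ (1 + (q - γ1)) * F 0 := mul_nonneg (by linarith) (hF 0)
  calc F (k + 1) ≤ F (k + 1) + (q - γ1) * F k := le_add_of_nonneg_right (mul_nonneg hδ (hF k))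
    _ ≤ q ^ (k + 1) * ((1 + (q - γ1)) * F 0) := main k
    _ ≤ q ^ k * ((1 + (q - γ1)) * F 0) :=
      mul_le_mul_of_nonneg_right (pow_le_pow_of_le_one hq0 hq1 k.le_succ) hC
    _ = _ := by ring

/-- Theorem 3.2: deterministic linear convergence of mGRK.
The projection `xs = A†b + (I - A†A)x⁰` is encoded by `⟪a i, xs⟫ = b i` and
`x 0 - xs ∈ Range(Aᵀ) = span {a₁,…,a_m}`; the smallest nonzero singular value `σ`
by `σ > 0` and `σ²‖z‖² ≤ ∑ i ⟪a i, z⟫²` for `z ∈ Range(Aᵀ)`.  The iteration starts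
from `x⁰ = x^{-1}` (truncated subtraction: `x (k-1) = x 0` at `k = 0`); at each step
`Ax^k ≠ b` and `i_k` is an arbitrary index of the relaxed greedy set `S_k` with
threshold parameter `Γ_k = Γ(x^k)`.  Then `γ₁ + γ₂ ≤ q < 1` and
`‖x^{k+1} - xs‖² ≤ q^k (1 + δ) ‖x⁰ - xs‖²` for all `k ≥ 0`. -/
theorem mGRK_deterministic_linear_convergence {m n : ℕ} [Nonempty (Fin m)]
    (a : Fin m → EuclideanSpace ℝ (Fin n)) (b : Fin m → ℝ)
    (ha : ∀ i, a i ≠ 0)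
    (xs : EuclideanSpace ℝ (Fin n)) (hxs : ∀ i, ⟪a i, xs⟫ = b i)
    (σ : ℝ) (hσpos : 0 < σ)
    (hσ : ∀ z ∈ Submodule.span ℝ (Set.range a), σ ^ 2 * ‖z‖ ^ 2 ≤ ∑ i, ⟪a i, z⟫ ^ 2)
    (θ α β : ℝ) (hθ0 : 0 ≤ θ) (hθ1 : θ ≤ 1) (hβ : 0 ≤ β)
    (hα : (β = 0 → 0 < α ∧ α < 2) ∧ (0 < β → 0 < α ∧ α < 1 + β))
    (γ1 γ2 : ℝ)
    (hγ1 : γ1 = 2 * β ^ 2 + 3 * β + 1 -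
      (3 * α * β + 2 * α - α ^ 2) * σ ^ 2 / ∑ i, ‖a i‖ ^ 2)
    (hγ2 : γ2 = 2 * β ^ 2 + β)
    (hsum : γ1 + γ2 < 1)
    (q δ : ℝ)
    (hq : (0 < γ2 → q = (γ1 + Real.sqrt (γ1 ^ 2 + 4 * γ2)) / 2) ∧ (γ2 = 0 → q = γ1))
    (hδ : δ = q - γ1)
    (x : ℕ → EuclideanSpace ℝ (Fin n))
    (hx0 : x 0 - xs ∈ Submodule.span ℝ (Set.range a))
    (idx : ℕ → Fin m)
    (hne : ∀ k : ℕ, ∃ i, ⟪a i, x k⟫ ≠ b i)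
    (hik : ∀ k : ℕ,
      (⟪a (idx k), x k⟫ - b (idx k)) ^ 2 / ‖a (idx k)‖ ^ 2 ≥
        θ * (Finset.univ.sup' Finset.univ_nonempty fun j => (⟪a j, x k⟫ - b j) ^ 2 / ‖a j‖ ^ 2) +
          (1 - θ) *
            ((∑ j, (⟪a j, x k⟫ - b j) ^ 2) /
              (∑ j ∈ Finset.univ.filter (fun j => ⟪a j, x k⟫ ≠ b j), ‖a j‖ ^ 2)))
    (hrec : ∀ k : ℕ,
      x (k + 1) =
        x k - α • (((⟪a (idx k), x k⟫ - b (idx k)) / ‖a (idx k)‖ ^ 2) • a (idx k)) +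
          β • (x k - x (k - 1))) :
    (γ1 + γ2 ≤ q ∧ q < 1) ∧
      ∀ k : ℕ, ‖x (k + 1) - xs‖ ^ 2 ≤ q ^ k * (1 + δ) * ‖x 0 - xs‖ ^ 2 := by
  have hres : ∀ k j, ⟪a j, x k⟫ - b j = ⟪a j, x k - xs⟫ := fun k j => by
    rw [inner_sub_right, hxs]
  have herr : ∀ k, x (k + 1) - xs =
      (x k - xs) - α • ((⟪a (idx k), x k - xs⟫ / ‖a (idx k)‖ ^ 2) • a (idx k)) +
        β • ((x k - xs) - (x (k - 1) - xs)) := fun k => by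
    rw [hrec k, hres, sub_sub_sub_cancel_right]
    abel
  have hmem : ∀ k, x k - xs ∈ Submodule.span ℝ (Set.range a) ∧
      x (k - 1) - xs ∈ Submodule.span ℝ (Set.range a) := by
    intro k
    induction k with
    | zero => exact ⟨hx0, hx0⟩
    | succ k ih =>
      refine ⟨?_, ih.1⟩
      rw [herr k]
      exact add_mem (sub_mem ih.1 (Submodule.smul_mem _ _ (Submodule.smul_mem _ _
        (Submodule.subset_span ⟨idx k, rfl⟩)))) (Submodule.smul_mem _ _ (sub_mem ih.1 ih.2))
  have hα0 : 0 < α := by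
    rcases hβ.eq_or_lt with h | h
    exacts [(hα.1 h.symm).1, (hα.2 h).1]
  have hcoef : 0 ≤ 3 * α * β + 2 * α - α ^ 2 := by
    have : 0 ≤ α * (3 * β + 2 - α) := by
      refine mul_nonneg hα0.le ?_
      rcases hβ.eq_or_lt with h | h
      · linarith [(hα.1 h.symm).2]
      · linarith [(hα.2 h).2]
    linarith
  have ha2 : ∀ i, 0 < ‖a i‖ ^ 2 := fun i => pow_pos (norm_pos_iff.2 (ha i)) 2
  have hS : 0 < ∑ i, ‖a i‖ ^ 2 := Finset.sum_pos (fun i _ => ha2 i) Finset.univ_nonempty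
  have hgreedy : ∀ k, σ ^ 2 * ‖x k - xs‖ ^ 2 / ∑ i, ‖a i‖ ^ 2 ≤
      ⟪a (idx k), x k - xs⟫ ^ 2 / ‖a (idx k)‖ ^ 2 := fun k => by
    have hthr := sum_sq_div_sum_le_greedy_threshold (fun j => ⟪a j, x k⟫ - b j)
      (fun j => ‖a j‖ ^ 2) ha2 ((hne k).imp fun _ => sub_ne_zero.2) hθ0 hθ1
      (Finset.univ.filter fun j => ⟪a j, x k⟫ ≠ b j) (fun j => by simp [sub_ne_zero])
    have h := hthr.trans (hik k)
    simp only [hres] at h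
    exact (div_le_div_of_nonneg_right (hσ _ (hmem k).1) hS.le).trans h
  have hstep : ∀ k, ‖x (k + 1) - xs‖ ^ 2 ≤
      γ1 * ‖x k - xs‖ ^ 2 + γ2 * ‖x (k - 1) - xs‖ ^ 2 := fun k => by
    have h := norm_sq_momentum_step_le (ha (idx k)) (x k - xs) (x (k - 1) - xs) hα0.le hβ
      fun h => (hα.2 h).2.le
    rw [← herr k] at h
    have hg := mul_le_mul_of_nonneg_left (hgreedy k) hcoef
    rw [hγ1, hγ2]
    calc _ ≤ _ := h
      _ ≤ _ := sub_le_sub_left hg _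
      _ = _ := by ring
  have hq_all : γ1 + γ2 ≤ q ∧ q < 1 ∧ 0 ≤ q ∧ 0 ≤ q - γ1 ∧ q * (q - γ1) = γ2 := by
    have hγ2nn : 0 ≤ γ2 := by rw [hγ2]; positivity
    rcases hγ2nn.eq_or_lt with h | h
    · have hqγ := hq.2 h.symm
      have he0 : 0 < ‖x 0 - xs‖ ^ 2 := by
        obtain ⟨i, hi⟩ := hne 0
        refine pow_pos (norm_pos_iff.2 (sub_ne_zero.2 ?_)) 2
        rintro h0
        exact hi (h0 ▸ hxs i)
      have hγ1nn : 0 ≤ γ1 := by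
        have h1 := hstep 0
        rw [← h, zero_mul, add_zero] at h1
        exact nonneg_of_mul_nonneg_left ((sq_nonneg _).trans h1) he0
      refine ⟨?_, ?_, ?_, ?_, ?_⟩ <;> rw [hqγ] <;> linarith
    · exact quadratic_root_bounds h hsum (hq.1 h)
  obtain ⟨hlow, hlt, hq0, hδ0, hroot⟩ := hq_all
  refine ⟨⟨hlow, hlt⟩, fun k => ?_⟩
  rw [hδ]
  exact two_term_recursion_le (F := fun k => ‖x k - xs‖ ^ 2) (fun k => sq_nonneg _) hstep
    hq0 hlt.le hδ0 hroot k
end
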